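/- If a Delone set Λ ⊆ ℝ^N is repetitive and satisfies positivity of quasiweights (PQ), then for every ball pattern P on Λ the frequency lim_{|C|→∞} ♯_P C / |C| exists, where C ranges over cubes in ℝ^N. -/

import Mathlib

open Filter MeasureTheory Bornology
open scoped ENNReal

noncomputable section

/-- Euclidean space `ℝ^N`. -/
abbrev Euc (N : ℕ) := EuclideanSpace ℝ (Fin N)

/-- The packing radius of a set: half of the infimum of distances between
distinct points (`⊤` if no such pair exists). -/
def rPack {N : ℕ} (Λ : Set (Euc N)) : ℝ≥0∞ :=
  ⨅ (x ∈ Λ) (y ∈ Λ) (_ : x ≠ y), edist x y / 2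

/-- The covering radius of a set: the supremum over all points of the space of
the distance to the set. -/
def rCov {N : ℕ} (Λ : Set (Euc N)) : ℝ≥0∞ :=
  ⨆ p : Euc N, EMetric.infEdist p Λ

/-- A set is uniformly discrete if its packing radius is positive. -/
def UniformlyDiscrete {N : ℕ} (Λ : Set (Euc N)) : Prop := 0 < rPack Λ

/-- A set is relatively dense if its covering radius is finite. -/
def RelativelyDense {N : ℕ} (Λ : Set (Euc N)) : Prop := rCov Λ < ⊤

/-- A Delone set is a uniformly discrete and relatively dense set. -/
def IsDelone {N : ℕ} (Λ : Set (Euc N)) : Prop :=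
  UniformlyDiscrete Λ ∧ RelativelyDense Λ

/-- Λ is non-periodic if no nonzero translate of Λ equals Λ. -/
def NonPeriodic {N : ℕ} (Λ : Set (Euc N)) : Prop :=
  ∀ t : Euc N, t ≠ 0 → (fun p => p - t) '' Λ ≠ Λ

/-- The patch of the ball pattern `(x, R)`: `(Λ - x) ∩ B_R`. -/
def patch {N : ℕ} (Λ : Set (Euc N)) (x : Euc N) (R : ℝ) : Set (Euc N) :=
  ((fun y => y - x) '' Λ) ∩ Metric.closedBall 0 R

/-- The locater set of the ball pattern `(x, R)`: the set of points of Λ whose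
`R`-patch agrees with that of `x`. -/
def locSet {N : ℕ} (Λ : Set (Euc N)) (x : Euc N) (R : ℝ) : Set (Euc N) :=
  {y ∈ Λ | patch Λ y R = patch Λ x R}

/-- Λ is repetitive if the locater set of every ball pattern is relatively dense. -/
def Repetitive {N : ℕ} (Λ : Set (Euc N)) : Prop :=
  ∀ x ∈ Λ, ∀ R : ℝ, 0 < R → RelativelyDense (locSet Λ x R)

/-- `L_P(Q)`: the points of the locater set of `(x,R)` whose `R`-ball lies inside `Q`. -/
def locIn {N : ℕ} (Λ : Set (Euc N)) (x : Euc N) (R : ℝ) (Q : Set (Euc N)) :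
    Set (Euc N) :=
  {y ∈ locSet Λ x R | Metric.closedBall y R ⊆ Q}

/-- `♯_P Q`: the number of copies of the ball pattern `P = (x,R)` in `Q`. -/
def countP {N : ℕ} (Λ : Set (Euc N)) (x : Euc N) (R : ℝ) (Q : Set (Euc N)) : ℕ :=
  (locIn Λ x R Q).ncard

/-- `♯'_P Q`: the maximal number of completely disjoint copies of `P = (x,R)` in `Q`. -/
def countP' {N : ℕ} (Λ : Set (Euc N)) (x : Euc N) (R : ℝ) (Q : Set (Euc N)) : ℕ :=
  sSup {n : ℕ | ∃ A : Finset (Euc N), ↑A ⊆ locIn Λ x R Q ∧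
    (∀ u ∈ A, ∀ v ∈ A, u ≠ v → 2 * R < dist u v) ∧ A.card = n}

/-- The cube with corner `a` and sidelength `s`. -/
def cube {N : ℕ} (a : Euc N) (s : ℝ) : Set (Euc N) :=
  {p | ∀ i, a i ≤ p i ∧ p i ≤ a i + s}

/-- The filter describing cubes `C` with `|C| → ∞`: arbitrary corner, sidelength
tending to infinity. -/
def cubeFilter (N : ℕ) : Filter (Euc N × ℝ) := (⊤ : Filter (Euc N)) ×ˢ atTop

/-- The Lebesgue measure `|B_R|` of a closed ball of radius `R` in `ℝ^N`. -/
def ballVol (N : ℕ) (R : ℝ) : ℝ := (volume (Metric.closedBall (0 : Euc N) R)).toReal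

/-- The lower density `ν(P)` of the ball pattern `P = (x,R)`:
`liminf_{|C|→∞} ♯_P C · |B_R| / |C|` over cubes `C`. -/
def nu {N : ℕ} (Λ : Set (Euc N)) (x : Euc N) (R : ℝ) : ℝ :=
  liminf (fun cs : Euc N × ℝ =>
    (countP Λ x R (cube cs.1 cs.2) : ℝ) * ballVol N R / cs.2 ^ N) (cubeFilter N)

/-- The lower reduced density `ν'(P)` of the ball pattern `P = (x,R)`:
`liminf_{|C|→∞} ♯'_P C · |B_R| / |C|` over cubes `C`. -/
def nu' {N : ℕ} (Λ : Set (Euc N)) (x : Euc N) (R : ℝ) : ℝ :=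
  liminf (fun cs : Euc N × ℝ =>
    (countP' Λ x R (cube cs.1 cs.2) : ℝ) * ballVol N R / cs.2 ^ N) (cubeFilter N)

/-- `w = inf {ν(P) : r(P) ≥ 1}`. -/
def wPW {N : ℕ} (Λ : Set (Euc N)) : ℝ :=
  sInf {v | ∃ x ∈ Λ, ∃ R : ℝ, 1 ≤ R ∧ v = nu Λ x R}

/-- `w' = inf {ν'(P) : r(P) ≥ 1}`. -/
def wPQ {N : ℕ} (Λ : Set (Euc N)) : ℝ :=
  sInf {v | ∃ x ∈ Λ, ∃ R : ℝ, 1 ≤ R ∧ v = nu' Λ x R}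

/-- Positivity of weights (PW). -/
def PW {N : ℕ} (Λ : Set (Euc N)) : Prop := 0 < wPW Λ

/-- Positivity of quasiweights (PQ). -/
def PQ {N : ℕ} (Λ : Set (Euc N)) : Prop := 0 < wPQ Λ

/-- A function on (bounded) subsets of `ℝ^N` is subadditive if
`F(Q₁ ∪ Q₂) ≤ F(Q₁) + F(Q₂)` for disjoint bounded `Q₁, Q₂`. -/
def SubadditiveFn {N : ℕ} (F : Set (Euc N) → ℝ) : Prop :=
  ∀ Q₁ Q₂ : Set (Euc N), IsBounded Q₁ → IsBounded Q₂ → Disjoint Q₁ Q₂ →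
    F (Q₁ ∪ Q₂) ≤ F Q₁ + F Q₂

/-- A function on (bounded) subsets is Λ-invariant if `F(Q) = F(t + Q)` whenever
`t + (Q ∩ Λ) = (t + Q) ∩ Λ`. -/
def InvariantFn {N : ℕ} (Λ : Set (Euc N)) (F : Set (Euc N) → ℝ) : Prop :=
  ∀ (t : Euc N) (Q : Set (Euc N)), IsBounded Q →
    (fun p => t + p) '' (Q ∩ Λ) = ((fun p => t + p) '' Q) ∩ Λ →
    F Q = F ((fun p => t + p) '' Q)

/-- Λ satisfies the subadditive ergodic theorem (SET) if for every subadditive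
Λ-invariant function `F` the limit `lim_{|C|→∞} F(C)/|C|` over cubes exists. -/
def SET {N : ℕ} (Λ : Set (Euc N)) : Prop :=
  ∀ F : Set (Euc N) → ℝ, SubadditiveFn F → InvariantFn Λ F →
    ∃ L : ℝ, Tendsto (fun cs : Euc N × ℝ => F (cube cs.1 cs.2) / cs.2 ^ N)
      (cubeFilter N) (nhds L)

/-- Linear repetitivity (LR): `sup {r_cov(L_P)/r(P) : r(P) ≥ 1} < ∞`. -/
def LR {N : ℕ} (Λ : Set (Euc N)) : Prop :=
  (⨆ (x ∈ Λ) (R : ℝ) (_ : 1 ≤ R), rCov (locSet Λ x R) / ENNReal.ofReal R) < ⊤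

/-- The repulsion property (RP): `inf {r_pack(L_P)/r(P) : P a ball pattern} > 0`. -/
def RP {N : ℕ} (Λ : Set (Euc N)) : Prop :=
  0 < ⨅ (x ∈ Λ) (R : ℝ) (_ : 0 < R), rPack (locSet Λ x R) / ENNReal.ofReal R

/-- The Voronoi cell of `x` with respect to `Γ`. -/
def voronoiCell {N : ℕ} (Γ : Set (Euc N)) (x : Euc N) : Set (Euc N) :=
  {p | ∀ y ∈ Γ, dist p x ≤ dist p y}

/-- The inner radius of a set `V` around `x`. -/
def rIn {N : ℕ} (x : Euc N) (V : Set (Euc N)) : ℝ≥0∞ :=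
  sSup {R : ℝ≥0∞ | EMetric.closedBall x R ⊆ V}

/-- The outer radius of a set `V` around `x`. -/
def rOut {N : ℕ} (x : Euc N) (V : Set (Euc N)) : ℝ≥0∞ :=
  sInf {R : ℝ≥0∞ | V ⊆ EMetric.closedBall x R}

/-- The distortion `λ(V) = r_out(V)/r_in(V)` of a set `V` around `x`. -/
def distortion {N : ℕ} (x : Euc N) (V : Set (Euc N)) : ℝ≥0∞ := rOut x V / rIn x V

/-- The distortion of a discrete set: the supremum of the distortions of its
Voronoi cells. -/
def setDistortion {N : ℕ} (Γ : Set (Euc N)) : ℝ≥0∞ :=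
  ⨆ x ∈ Γ, distortion x (voronoiCell Γ x)

/-- Uniformity of return words (U): the distortions of all locater sets of Λ are
uniformly bounded. -/
def URW {N : ℕ} (Λ : Set (Euc N)) : Prop :=
  (⨆ (x ∈ Λ) (R : ℝ) (_ : 0 < R), setDistortion (locSet Λ x R)) < ⊤

end

section Cubes

variable {N : ℕ}

lemma dist_le_of_forall_abs_sub_le {p q : Euc N} {t : ℝ} (ht : 0 ≤ t)
    (h : ∀ i, |p i - q i| ≤ t) : dist p q ≤ N * t := by
  rw [EuclideanSpace.dist_eq]
  refine Real.sqrt_le_iff.2 ⟨by positivity, ?_⟩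
  have hsum : ∑ i, dist (p i) (q i) ^ 2 ≤ ∑ _i : Fin N, t ^ 2 := by
    refine Finset.sum_le_sum fun i _ => ?_
    rw [Real.dist_eq]
    exact pow_le_pow_left₀ (abs_nonneg _) (h i) 2
  refine hsum.trans ?_
  have hN : (N : ℝ) ≤ (N : ℝ) ^ 2 := by exact_mod_cast Nat.le_self_pow two_ne_zero N
  simp only [Finset.sum_const, Finset.card_univ, Fintype.card_fin, nsmul_eq_mul]
  rw [mul_pow]
  exact mul_le_mul_of_nonneg_right hN (sq_nonneg t)

lemma abs_apply_sub_le_dist (p q : Euc N) (i : Fin N) : |p i - q i| ≤ dist p q := by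
  rw [dist_eq_norm]
  simpa using PiLp.norm_apply_le (p - q) i

/-- The multi-index of the half-open cube containing `p`, in the grid of mesh `s` based at `a`. -/
noncomputable def gridIndex (a : Euc N) (s : ℝ) (p : Euc N) : Fin N → ℤ := fun i => ⌊(p i - a i) / s⌋

/-- The lower corner of the grid cube with multi-index `k`. -/
noncomputable def gridCorner (a : Euc N) (s : ℝ) (k : Fin N → ℤ) : Euc N :=
  WithLp.toLp 2 fun i => a i + s * k i

/-- The multi-indices of the grid cubes contained in `cube b t`. -/
noncomputable def gridIndicesIn (a : Euc N) (s : ℝ) (b : Euc N) (t : ℝ) : Finset (Fin N → ℤ) :=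
  Fintype.piFinset fun i =>
    Finset.Icc ⌈(b i - a i) / s⌉ (⌊(b i - a i + t) / s⌋ - 1)

/-- The multi-indices of the grid cubes based at `a` which cover `cube a T`. -/
noncomputable def gridCover (N : ℕ) (s T : ℝ) : Finset (Fin N → ℤ) :=
  Fintype.piFinset fun _ => Finset.Icc 0 ⌊T / s⌋

lemma mem_cube_gridCorner {a : Euc N} {s : ℝ} (hs : 0 < s) (p : Euc N) :
    p ∈ cube (gridCorner a s (gridIndex a s p)) s := by
  intro i
  have h₁ := Int.floor_le ((p i - a i) / s)
  have h₂ := Int.lt_floor_add_one ((p i - a i) / s)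
  rw [le_div_iff₀ hs] at h₁
  rw [div_lt_iff₀ hs] at h₂
  simp only [gridCorner, gridIndex]
  constructor <;> nlinarith

lemma cube_gridCorner_subset {a b : Euc N} {s t : ℝ} (hs : 0 < s) {k : Fin N → ℤ}
    (hk : k ∈ gridIndicesIn a s b t) : cube (gridCorner a s k) s ⊆ cube b t := by
  intro p hp i
  have hki := Finset.mem_Icc.1 (Fintype.mem_piFinset.1 hk i)
  have h₁ : (b i - a i) / s ≤ k i := Int.ceil_le.1 hki.1
  have h₂ : ((k i + 1 : ℤ) : ℝ) ≤ (b i - a i + t) / s := Int.le_floor.1 (by linarith [hki.2])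
  rw [div_le_iff₀ hs] at h₁
  rw [le_div_iff₀ hs] at h₂
  push_cast at h₂
  have hpi := hp i
  simp only [gridCorner] at hpi
  constructor <;> nlinarith [hpi.1, hpi.2]

lemma gridCorner_mem_cube (a : Euc N) {s : ℝ} (hs : 0 < s) (k : Fin N → ℤ) :
    gridCorner a s k ∈ cube (gridCorner a s k) s :=
  fun _ => ⟨le_rfl, by linarith⟩

lemma gridIndex_mem_gridCover {a p : Euc N} {s T : ℝ} (hs : 0 < s) (hp : p ∈ cube a T) :
    gridIndex a s p ∈ gridCover N s T := by
  refine Fintype.mem_piFinset.2 fun i => Finset.mem_Icc.2 ⟨?_, ?_⟩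
  · exact Int.floor_nonneg.2 (div_nonneg (by linarith [(hp i).1]) hs.le)
  · exact Int.floor_le_floor (div_le_div_of_nonneg_right (by linarith [(hp i).2]) hs.le)

lemma card_gridCover_le {s T : ℝ} (hs : 0 < s) (hT : 0 ≤ T) :
    ((gridCover N s T).card : ℝ) ≤ (T / s + 1) ^ N := by
  have h₀ : 0 ≤ ⌊T / s⌋ := Int.floor_nonneg.2 (div_nonneg hT hs.le)
  have hcast : (((⌊T / s⌋ + 1).toNat : ℕ) : ℝ) = (⌊T / s⌋ : ℝ) + 1 := by
    have : (((⌊T / s⌋ + 1).toNat : ℤ) : ℝ) = ((⌊T / s⌋ + 1 : ℤ) : ℝ) := by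
      rw [Int.toNat_of_nonneg (by linarith)]
    exact_mod_cast this
  simp only [gridCover, Fintype.card_piFinset, Int.card_Icc, sub_zero, Finset.prod_const,
    Finset.card_univ, Fintype.card_fin, Nat.cast_pow, hcast]
  have h₁ : (0 : ℝ) ≤ ⌊T / s⌋ := by exact_mod_cast h₀
  exact pow_le_pow_left₀ (by linarith) (by linarith [Int.floor_le (T / s)]) N

lemma le_card_gridIndicesIn (a b : Euc N) {s t : ℝ} (hs : 0 < s) (ht : 2 * s ≤ t) :
    (t / s - 2) ^ N ≤ ((gridIndicesIn a s b t).card : ℝ) := by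
  simp only [gridIndicesIn, Fintype.card_piFinset, Int.card_Icc, Nat.cast_prod]
  have h₀ : 0 ≤ t / s - 2 := by
    rw [sub_nonneg, le_div_iff₀ hs]
    exact ht
  calc (t / s - 2) ^ N = ∏ _i : Fin N, (t / s - 2) := by simp
    _ ≤ _ := by
      refine Finset.prod_le_prod (fun _ _ => h₀) fun i _ => ?_
      have h₁ := Int.ceil_lt_add_one ((b i - a i) / s)
      have h₂ := Int.lt_floor_add_one ((b i - a i + t) / s)
      rw [add_div] at h₂
      have h₃ : ((⌊(b i - a i + t) / s⌋ - 1 + 1 - ⌈(b i - a i) / s⌉ : ℤ) : ℝ) ≤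
          ((⌊(b i - a i + t) / s⌋ - 1 + 1 - ⌈(b i - a i) / s⌉).toNat : ℝ) := by
        exact_mod_cast Int.self_le_toNat _
      push_cast at h₃
      rw [add_div] at h₃ ⊢
      linarith

lemma gridIndicesIn_subset_gridCover {a b : Euc N} {s t T : ℝ} (hs : 0 < s)
    (h : cube b t ⊆ cube a T) : gridIndicesIn a s b t ⊆ gridCover N s T := by
  intro k hk
  have hmem := h (cube_gridCorner_subset hs hk (gridCorner_mem_cube a hs k))
  convert gridIndex_mem_gridCover hs hmem using 1
  ext i
  simp [gridIndex, gridCorner, hs.ne']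

lemma disjoint_gridIndicesIn {a b b' : Euc N} {s t : ℝ} (hs : 0 < s)
    (h : Disjoint (cube b t) (cube b' t)) :
    Disjoint (gridIndicesIn a s b t) (gridIndicesIn a s b' t) := by
  refine Finset.disjoint_left.2 fun k hk hk' => ?_
  exact Set.disjoint_left.1 h
    (cube_gridCorner_subset hs hk (gridCorner_mem_cube a hs k))
    (cube_gridCorner_subset hs hk' (gridCorner_mem_cube a hs k))

/-- If every cube of side `s` holds at most `α` points of `L`, and `cube a T` contains disjoint
cubes of side `t` which each hold at most `γ` points of `L`, then the latter improve the bound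
on the number of points of `L` in `cube a T` that comes from the grid of mesh `s`. -/
lemma ncard_inter_cube_le {L : Set (Euc N)} (hfin : ∀ a s, (L ∩ cube a s).Finite)
    {s t T α γ : ℝ} (hs : 0 < s) (ht : 2 * s ≤ t) (hT : 0 ≤ T)
    (hα : ∀ b, ((L ∩ cube b s).ncard : ℝ) ≤ α) (a : Euc N) {ι : Type*} (A : Finset ι)
    (b : ι → Euc N) (hsub : ∀ u ∈ A, cube (b u) t ⊆ cube a T)
    (hdisj : ∀ u ∈ A, ∀ v ∈ A, u ≠ v → Disjoint (cube (b u) t) (cube (b v) t))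
    (hγ : ∀ u ∈ A, ((L ∩ cube (b u) t).ncard : ℝ) ≤ γ) :
    ((L ∩ cube a T).ncard : ℝ) ≤
      α * ((T / s + 1) ^ N - A.card * (t / s - 2) ^ N) + A.card * γ := by
  classical
  set F := (hfin a T).toFinset with hF
  have hα₀ : 0 ≤ α := (Nat.cast_nonneg _).trans (hα a)
  set J := A.biUnion fun u => gridIndicesIn a s (b u) t with hJ
  have hJdisj : (A : Set ι).PairwiseDisjoint fun u => gridIndicesIn a s (b u) t :=
    fun u hu v hv huv => disjoint_gridIndicesIn hs (hdisj u hu v hv huv)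
  have hJsub : J ⊆ gridCover N s T :=
    Finset.biUnion_subset.2 fun u hu => gridIndicesIn_subset_gridCover hs (hsub u hu)
  set f : (Fin N → ℤ) → ℕ := fun k => (F.filter fun p => gridIndex a s p = k).card with hf
  have hcard : F.card = ∑ k ∈ gridCover N s T, f k := by
    refine Finset.card_eq_sum_card_fiberwise fun p hp => ?_
    exact gridIndex_mem_gridCover hs (((hfin a T).mem_toFinset.1 hp).2)
  have hfα : ∀ k, (f k : ℝ) ≤ α := by
    intro k
    refine le_trans ?_ (hα (gridCorner a s k))
    simp only [hf]
    rw [← Set.ncard_coe_finset]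
    refine Nat.cast_le.2 (Set.ncard_le_ncard ?_ (hfin _ _))
    intro p hp
    obtain ⟨hpF, rfl⟩ := Finset.mem_filter.1 (Finset.mem_coe.1 hp)
    exact ⟨((hfin a T).mem_toFinset.1 hpF).1, mem_cube_gridCorner hs p⟩
  have hfγ : ∀ u ∈ A, (∑ k ∈ gridIndicesIn a s (b u) t, (f k : ℝ)) ≤ γ := by
    intro u hu
    refine le_trans ?_ (hγ u hu)
    have hsum : ∑ k ∈ gridIndicesIn a s (b u) t, f k =
        (F.filter fun p => gridIndex a s p ∈ gridIndicesIn a s (b u) t).card := by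
      rw [Finset.card_eq_sum_card_fiberwise (f := gridIndex a s)
        (s := F.filter fun p => gridIndex a s p ∈ gridIndicesIn a s (b u) t)
        (t := gridIndicesIn a s (b u) t) fun p hp => (Finset.mem_filter.1 (Finset.mem_coe.1 hp)).2]
      refine Finset.sum_congr rfl fun k hk => ?_
      simp only [hf]
      rw [Finset.filter_filter]
      congr 1
      refine Finset.filter_congr fun p _ => ⟨fun h => ⟨h ▸ hk, h⟩, fun h => h.2⟩
    rw [← Nat.cast_sum, hsum, ← Set.ncard_coe_finset]
    refine Nat.cast_le.2 (Set.ncard_le_ncard ?_ (hfin _ _))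
    intro p hp
    obtain ⟨hpF, hpk⟩ := Finset.mem_filter.1 (Finset.mem_coe.1 hp)
    exact ⟨((hfin a T).mem_toFinset.1 hpF).1,
      cube_gridCorner_subset hs hpk (mem_cube_gridCorner hs p)⟩
  have hJcard : A.card * (t / s - 2) ^ N ≤ (J.card : ℝ) := by
    rw [hJ, Finset.card_biUnion hJdisj, Nat.cast_sum, ← nsmul_eq_mul]
    exact Finset.card_nsmul_le_sum _ _ _ fun u _ => le_card_gridIndicesIn a (b u) hs ht
  have hsdiff : (((gridCover N s T) \ J).card : ℝ) ≤
      (T / s + 1) ^ N - A.card * (t / s - 2) ^ N := by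
    rw [Finset.cast_card_sdiff hJsub]
    linarith [card_gridCover_le (N := N) hs hT]
  rw [Set.ncard_eq_toFinset_card _ (hfin a T), ← hF, hcard, Nat.cast_sum,
    ← Finset.sum_sdiff hJsub, hJ, Finset.sum_biUnion hJdisj, ← hJ]
  refine add_le_add ?_ ?_
  · calc ∑ k ∈ gridCover N s T \ J, (f k : ℝ) ≤ (gridCover N s T \ J).card • α :=
        Finset.sum_le_card_nsmul _ _ _ fun k _ => hfα k
      _ = α * (gridCover N s T \ J).card := by rw [nsmul_eq_mul, mul_comm]
      _ ≤ _ := mul_le_mul_of_nonneg_left hsdiff hα₀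
  · rw [← nsmul_eq_mul]
    exact Finset.sum_le_card_nsmul _ _ _ hfγ

end Cubes

section Delone

variable {N : ℕ} {Λ : Set (Euc N)}

lemma UniformlyDiscrete.exists_pos_le_dist (h : UniformlyDiscrete Λ) :
    ∃ δ : ℝ, 0 < δ ∧ ∀ x ∈ Λ, ∀ y ∈ Λ, x ≠ y → δ ≤ dist x y := by
  obtain ⟨c, hc₀, hc⟩ := ENNReal.lt_iff_exists_nnreal_btwn.1 h
  refine ⟨c, by exact_mod_cast hc₀, fun x hx y hy hxy => ?_⟩
  have h₁ : rPack Λ ≤ edist x y / 2 := iInf₂_le_of_le x hx <| iInf₂_le_of_le y hy <|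
    iInf_le_of_le hxy le_rfl
  have h₂ : (c : ℝ≥0∞) ≤ edist x y := (hc.le.trans h₁).trans ENNReal.half_le_self
  rw [edist_nndist] at h₂
  exact_mod_cast h₂

lemma RelativelyDense.exists_dist_le (h : RelativelyDense Λ) :
    ∃ r : ℝ, 0 < r ∧ ∀ p, ∃ y ∈ Λ, dist p y ≤ r := by
  obtain ⟨c, hc, -⟩ := ENNReal.lt_iff_exists_nnreal_btwn.1 h
  refine ⟨c + 1, by positivity, fun p => ?_⟩
  have h₁ : Metric.infEDist p Λ < c := (le_iSup (fun p => Metric.infEDist p Λ) p).trans_lt hc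
  obtain ⟨y, hy, hlt⟩ := Metric.infEDist_lt_iff.1 h₁
  refine ⟨y, hy, ?_⟩
  rw [edist_nndist] at hlt
  have h₂ : dist p y < c := by exact_mod_cast hlt
  linarith

/-- A subset of a uniformly discrete set has finitely many points in every cube, and their number
grows at most like the volume. -/
lemma UniformlyDiscrete.finite_inter_cube (h : UniformlyDiscrete Λ) {L : Set (Euc N)}
    (hL : L ⊆ Λ) :
    (∀ a s, (L ∩ cube a s).Finite) ∧
      ∃ K : ℝ, ∀ a, ∀ s : ℝ, 1 ≤ s → ((L ∩ cube a s).ncard : ℝ) ≤ K * s ^ N := by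
  obtain ⟨δ, hδ, hsep⟩ := h.exists_pos_le_dist
  set ε := δ / (N + 1) with hε
  have hε₀ : 0 < ε := by positivity
  have hεδ : N * ε < δ := by
    rw [hε, mul_div_assoc', div_lt_iff₀ (by positivity)]
    nlinarith
  have hinj : ∀ a, Set.InjOn (gridIndex a ε) L := by
    intro a p hp q hq hpq
    by_contra hne
    have hp' := mem_cube_gridCorner (a := a) hε₀ p
    have hq' := mem_cube_gridCorner (a := a) hε₀ q
    rw [hpq] at hp'
    have hd : dist p q ≤ N * ε := dist_le_of_forall_abs_sub_le hε₀.le fun i => by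
      rw [abs_le]
      constructor <;> linarith [(hp' i).1, (hp' i).2, (hq' i).1, (hq' i).2]
    linarith [hsep p (hL hp) q (hL hq) hne]
  have hmaps : ∀ a s, Set.MapsTo (gridIndex a ε) (L ∩ cube a s) (gridCover N ε s) :=
    fun a s p hp => gridIndex_mem_gridCover hε₀ hp.2
  refine ⟨fun a s => Set.Finite.of_injOn (hmaps a s) ((hinj a).mono Set.inter_subset_left)
    (Finset.finite_toSet _), (1 / ε + 1) ^ N, fun a s hs => ?_⟩
  have h₁ : (L ∩ cube a s).ncard ≤ (gridCover N ε s).card := by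
    rw [← Set.ncard_coe_finset]
    exact Set.ncard_le_ncard_of_injOn _ (hmaps a s) ((hinj a).mono Set.inter_subset_left)
      (Finset.finite_toSet _)
  calc ((L ∩ cube a s).ncard : ℝ) ≤ (gridCover N ε s).card := by exact_mod_cast h₁
    _ ≤ (s / ε + 1) ^ N := card_gridCover_le hε₀ (by linarith)
    _ ≤ ((1 / ε + 1) * s) ^ N := by
      refine pow_le_pow_left₀ (by positivity) ?_ N
      rw [add_mul, one_div_mul_eq_div]
      linarith
    _ = _ := mul_pow _ _ _

lemma patch_eq_iff {x y : Euc N} {R : ℝ} :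
    patch Λ x R = patch Λ y R ↔ ∀ v : Euc N, ‖v‖ ≤ R → (x + v ∈ Λ ↔ y + v ∈ Λ) := by
  have hmem : ∀ z v : Euc N, v ∈ patch Λ z R ↔ z + v ∈ Λ ∧ ‖v‖ ≤ R := by
    intro z v
    simp only [patch, Set.mem_inter_iff, Set.mem_image, mem_closedBall_zero_iff]
    refine and_congr_left fun _ => ⟨?_, fun hv => ⟨z + v, hv, by simp⟩⟩
    rintro ⟨w, hw, rfl⟩
    simpa using hw
  simp only [Set.ext_iff, hmem]
  exact ⟨fun h v hv => by simpa [hv] using h v, fun h v => and_congr_left fun hv => h v hv⟩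

/-- Translating from one occurrence of a large pattern to another preserves membership in the
locater set of a smaller pattern. -/
lemma add_mem_locSet {x y u v : Euc N} {R R₀ : ℝ} (hR₀ : 0 ≤ R₀) (hu : u ∈ locSet Λ y R)
    (hv : ‖v‖ + R₀ ≤ R) (h : u + v ∈ locSet Λ x R₀) : y + v ∈ locSet Λ x R₀ := by
  have huy := patch_eq_iff.1 hu.2
  refine ⟨(huy v (by linarith)).1 h.1, ?_⟩
  rw [← h.2, patch_eq_iff]
  intro z hz
  rw [add_assoc, add_assoc]
  exact (huy (v + z) ((norm_add_le v z).trans (by linarith))).symm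

/-- Positivity of quasiweights, in terms of families of disjoint occurrences. -/
lemma PQ.exists_separated (h : PQ Λ) : ∃ w : ℝ, 0 < w ∧ ∀ y ∈ Λ, ∀ R : ℝ, 1 ≤ R →
    ∃ T₀ : ℝ, ∀ T, T₀ ≤ T → ∀ a : Euc N, ∃ A : Finset (Euc N),
      ↑A ⊆ locIn Λ y R (cube a T) ∧ (∀ u ∈ A, ∀ v ∈ A, u ≠ v → 2 * R < dist u v) ∧
      w * T ^ N ≤ A.card * ballVol N R := by
  have hw : 0 < wPQ Λ := h
  refine ⟨wPQ Λ / 2, by positivity, fun y hy R hR => ?_⟩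
  have hbdd : BddBelow {v | ∃ x ∈ Λ, ∃ R : ℝ, 1 ≤ R ∧ v = nu' Λ x R} := by
    by_contra hb
    exact hw.ne' (Real.sInf_of_not_bddBelow hb)
  have hnu : wPQ Λ / 2 < nu' Λ y R :=
    (half_lt_self hw).trans_le (csInf_le hbdd ⟨y, hy, R, hR, rfl⟩)
  rw [nu', liminf_eq] at hnu
  set S := {c : ℝ | ∀ᶠ cs in cubeFilter N,
    c ≤ (countP' Λ y R (cube cs.1 cs.2) : ℝ) * ballVol N R / cs.2 ^ N} with hS
  have hne : S.Nonempty := by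
    by_contra hempty
    rw [Set.not_nonempty_iff_eq_empty.1 hempty, Real.sSup_empty] at hnu
    linarith
  obtain ⟨c, hc, hlt⟩ := exists_lt_of_lt_csSup hne hnu
  obtain ⟨p, hp, q, hq, hpq⟩ := Filter.eventually_prod_iff.1 hc
  rw [eventually_top] at hp
  obtain ⟨T₀, hT₀⟩ := eventually_atTop.1 hq
  refine ⟨max T₀ 1, fun T hT a => ?_⟩
  have hle := hpq (hp a) (hT₀ T ((le_max_left _ _).trans hT))
  have hT₁ : 0 < T ^ N := pow_pos (zero_lt_one.trans_le ((le_max_right _ _).trans hT)) N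
  have hcount := (le_div_iff₀ hT₁).1 (hlt.le.trans hle)
  simp only at hcount
  set n := countP' Λ y R (cube a T) with hn
  have hnpos : n ≠ 0 := by
    intro h0
    rw [h0, Nat.cast_zero, zero_mul] at hcount
    nlinarith
  have hmem : n ∈ {n : ℕ | ∃ A : Finset (Euc N), ↑A ⊆ locIn Λ y R (cube a T) ∧
      (∀ u ∈ A, ∀ v ∈ A, u ≠ v → 2 * R < dist u v) ∧ A.card = n} := by
    rw [hn, countP']
    refine Nat.sSup_mem ⟨0, ∅, by simp⟩ ?_
    by_contra hb
    exact hnpos (Nat.sSup_of_not_bddAbove hb)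
  obtain ⟨A, hA, hsep, hcard⟩ := hmem
  exact ⟨A, hA, hsep, by rw [hcard]; exact hcount⟩

lemma ballVol_eq (N : ℕ) {R : ℝ} (hR : 0 ≤ R) : ballVol N R = R ^ N * ballVol N 1 := by
  rw [ballVol, ballVol, Measure.addHaar_closedBall' _ _ hR, ENNReal.toReal_mul,
    ENNReal.toReal_ofReal (by positivity)]
  simp [Euc]

lemma ballVol_one_pos (N : ℕ) : 0 < ballVol N 1 :=
  ENNReal.toReal_pos (Metric.measure_closedBall_pos volume _ one_pos).ne'
    (isCompact_closedBall _ _).measure_lt_top.ne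

lemma mem_cube_iff_add {a p v : Euc N} {s : ℝ} : p + v ∈ cube (a + v) s ↔ p ∈ cube a s := by
  refine forall_congr' fun i => ?_
  simp only [PiLp.add_apply]
  constructor <;> rintro ⟨h₁, h₂⟩ <;> constructor <;> linarith

/-- A fixed cube reappears in every large cube, up to its content in locater points of `(x, R₀)`,
in a family of disjoint translates which occupy a proportion of the volume bounded below. -/
lemma exists_disjoint_translates (hdense : RelativelyDense Λ) (hPQ : PQ Λ) (x : Euc N) {R₀ : ℝ}
    (hR₀ : 0 < R₀) (hfin : ∀ a s, (locSet Λ x R₀ ∩ cube a s).Finite) :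
    ∃ w : ℝ, 0 < w ∧ ∃ t₀ : ℝ, ∀ t, t₀ ≤ t → ∀ c : Euc N,
      ∃ T₀ : ℝ, ∀ T, T₀ ≤ T → ∀ a : Euc N, ∃ (A : Finset (Euc N)) (b : Euc N → Euc N),
        (∀ u ∈ A, cube (b u) t ⊆ cube a T) ∧
        (∀ u ∈ A, ∀ v ∈ A, u ≠ v → Disjoint (cube (b u) t) (cube (b v) t)) ∧
        (∀ u ∈ A, (locSet Λ x R₀ ∩ cube (b u) t).ncard ≤ (locSet Λ x R₀ ∩ cube c t).ncard) ∧
        w * T ^ N ≤ A.card * t ^ N := by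
  obtain ⟨w, hw, hsep⟩ := hPQ.exists_separated
  obtain ⟨r, hr, hcov⟩ := hdense.exists_dist_le
  have hβ := ballVol_one_pos N
  have hκ : 0 < (N + 1 : ℝ) ^ N * ballVol N 1 := by positivity
  refine ⟨w / ((N + 1 : ℝ) ^ N * ballVol N 1), by positivity, r + R₀ + 1, fun t ht c => ?_⟩
  obtain ⟨y, hy, hcy⟩ := hcov c
  have ht₁ : 1 ≤ t := by linarith
  have hN : (0 : ℝ) ≤ N := Nat.cast_nonneg N
  obtain ⟨T₀, hT₀⟩ := hsep y hy ((N + 1) * t) (by nlinarith)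
  refine ⟨T₀, fun T hT a => ?_⟩
  obtain ⟨A, hA, hAsep, hcard⟩ := hT₀ T hT a
  have hnorm : ∀ p ∈ cube c t, ‖p - y‖ + R₀ ≤ (N + 1) * t := by
    intro p hp
    have h₁ : dist p c ≤ N * t := dist_le_of_forall_abs_sub_le (by linarith) fun i => by
      rw [abs_le]
      constructor <;> linarith [(hp i).1, (hp i).2]
    have h₂ := dist_triangle p c y
    rw [← dist_eq_norm]
    linarith
  have hback : ∀ u p, p ∈ cube (c + (u - y)) t → y + (p - u) ∈ cube c t := by
    intro u p hp
    have : y + (p - u) + (u - y) ∈ cube (c + (u - y)) t := by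
      convert hp using 1
      abel
    exact mem_cube_iff_add.1 this
  have hball : ∀ u p, p ∈ cube (c + (u - y)) t → ‖p - u‖ + R₀ ≤ (N + 1) * t := by
    intro u p hp
    simpa using hnorm _ (hback u p hp)
  refine ⟨A, fun u => c + (u - y), fun u hu p hp => ?_, fun u hu v hv huv => ?_,
    fun u hu => ?_, ?_⟩
  · refine (hA hu).2 ?_
    rw [Metric.mem_closedBall, dist_eq_norm]
    linarith [hball u p hp]
  · refine Set.disjoint_left.2 fun p hpu hpv => ?_
    have h₁ := hball u p hpu
    have h₂ := hball v p hpv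
    have h₃ := dist_triangle_left u v p
    rw [dist_eq_norm p u, dist_eq_norm p v] at h₃
    linarith [hAsep u hu v hv huv]
  · refine Set.ncard_le_ncard_of_injOn (fun p => y + (p - u)) (fun p hp => ⟨?_, ?_⟩)
      (fun p _ q _ hpq => by simpa using hpq) (hfin c t)
    · exact add_mem_locSet hR₀.le (hA hu).1 (hball u p hp.2) (by simpa using hp.1)
    · exact hback u p hp.2
  · rw [ballVol_eq N (by positivity), mul_pow] at hcard
    rw [div_mul_eq_mul_div, div_le_iff₀ hκ]
    linarith

lemma eventually_cubeFilter {p : Euc N × ℝ → Prop} :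
    (∀ᶠ cs in cubeFilter N, p cs) ↔ ∃ S : ℝ, ∀ s, S ≤ s → ∀ a, p (a, s) := by
  rw [cubeFilter, eventually_prod_iff]
  constructor
  · rintro ⟨pa, hpa, pb, hpb, h⟩
    rw [eventually_top] at hpa
    obtain ⟨S, hS⟩ := eventually_atTop.1 hpb
    exact ⟨S, fun s hs a => h (hpa a) (hS s hs)⟩
  · rintro ⟨S, hS⟩
    exact ⟨fun _ => True, by simp, fun s => S ≤ s, eventually_ge_atTop S,
      fun _ s hs => hS s hs _⟩

lemma frequently_cubeFilter {p : Euc N × ℝ → Prop} :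
    (∃ᶠ cs in cubeFilter N, p cs) ↔ ∀ S : ℝ, ∃ s, S ≤ s ∧ ∃ a, p (a, s) := by
  rw [Filter.Frequently, eventually_cubeFilter]
  push Not
  rfl

instance neBot_cubeFilter (N : ℕ) : (cubeFilter N).NeBot := by
  unfold cubeFilter
  infer_instance

lemma tendsto_add_div_pow (c : ℝ) (N : ℕ) :
    Tendsto (fun s : ℝ => ((s + c) / s) ^ N) atTop (nhds 1) := by
  have h₁ : Tendsto (fun s : ℝ => 1 + c / s) atTop (nhds (1 + 0)) :=
    tendsto_const_nhds.add (tendsto_const_nhds.div_atTop tendsto_id)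
  have h₂ : Tendsto (fun s : ℝ => (s + c) / s) atTop (nhds (1 + 0)) := by
    refine h₁.congr' ?_
    filter_upwards [eventually_gt_atTop 0] with s hs
    field_simp
  simpa using h₂.pow N

/-- The locater points of a pattern have a density which is uniform over cubes. -/
lemma exists_tendsto_ncard_locSet (hΛ : IsDelone Λ) (hPQ : PQ Λ) (x : Euc N) {R₀ : ℝ}
    (hR₀ : 0 < R₀) : ∃ l : ℝ, Tendsto
      (fun cs : Euc N × ℝ => ((locSet Λ x R₀ ∩ cube cs.1 cs.2).ncard : ℝ) / cs.2 ^ N)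
      (cubeFilter N) (nhds l) := by
  obtain ⟨hfin, K, hK⟩ := hΛ.1.finite_inter_cube (L := locSet Λ x R₀) (Set.sep_subset _ _)
  obtain ⟨w, hw, t₀, htrans⟩ := exists_disjoint_translates hΛ.2 hPQ x hR₀ hfin
  set L := locSet Λ x R₀
  set g : Euc N × ℝ → ℝ := fun cs => ((L ∩ cube cs.1 cs.2).ncard : ℝ) / cs.2 ^ N with hg
  have hbound : ∀ᶠ cs in cubeFilter N, 0 ≤ g cs ∧ g cs ≤ K := by
    refine eventually_cubeFilter.2 ⟨1, fun s hs a => ?_⟩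
    have hs₀ : 0 < s ^ N := pow_pos (by linarith) N
    exact ⟨by positivity, (div_le_iff₀ hs₀).2 (hK a s hs)⟩
  have habove : IsBoundedUnder (· ≤ ·) (cubeFilter N) g :=
    isBoundedUnder_of_eventually_le (hbound.mono fun _ h => h.2)
  have hbelow : IsBoundedUnder (· ≥ ·) (cubeFilter N) g :=
    isBoundedUnder_of_eventually_ge (hbound.mono fun _ h => h.1)
  refine ⟨liminf g (cubeFilter N), tendsto_of_le_liminf_of_limsup_le le_rfl ?_ habove hbelow⟩
  by_contra! hlt
  set l := liminf g (cubeFilter N) with hl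
  set U := limsup g (cubeFilter N) with hU
  have hl₀ : 0 ≤ l := le_liminf_of_le habove.isCoboundedUnder_ge (hbound.mono fun _ h => h.1)
  obtain ⟨ε, hε, hεd, hεw⟩ : ∃ ε : ℝ, 0 < ε ∧ ε ≤ (U - l) / 2 ∧ 3 * ε < (U - l) / 2 * w := by
    have hd : 0 < (U - l) / 2 := by linarith
    refine ⟨min ((U - l) / 2) ((U - l) / 2 * w / 4), by positivity, min_le_left _ _, ?_⟩
    have h₁ := min_le_right ((U - l) / 2) ((U - l) / 2 * w / 4)
    have h₂ : 0 < (U - l) / 2 * w := by positivity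
    linarith
  -- a mesh for which every cube has density at most `U + ε`
  obtain ⟨S, hS⟩ := eventually_cubeFilter.1
    (eventually_lt_of_limsup_lt (show limsup g (cubeFilter N) < U + ε by linarith) habove)
  set s := max S 1
  have hs : 0 < s := zero_lt_one.trans_le (le_max_right _ _)
  have hsN : 0 < s ^ N := pow_pos hs N
  have hα : ∀ b, ((L ∩ cube b s).ncard : ℝ) ≤ (U + ε) * s ^ N := fun b =>
    (div_le_iff₀ hsN).1 (hS s (le_max_left _ _) b).le
  -- a large cube of density at most `l + ε`
  have hcore : ∀ᶠ t : ℝ in atTop, U / (U + ε) < ((t + -(2 * s)) / t) ^ N :=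
    (tendsto_add_div_pow (-(2 * s)) N).eventually_const_lt
      ((div_lt_one (by linarith)).2 (by linarith))
  obtain ⟨t₁, ht₁⟩ := eventually_atTop.1 hcore
  obtain ⟨t, ht, c, hc⟩ := frequently_cubeFilter.1
    (frequently_lt_of_liminf_lt habove.isCoboundedUnder_ge
      (show liminf g (cubeFilter N) < l + ε by linarith)) (max (max t₀ t₁) (2 * s))
  have ht2 : 2 * s ≤ t := (le_max_right _ _).trans ht
  have ht₀ : t₀ ≤ t := ((le_max_left _ _).trans (le_max_left _ _)).trans ht
  have htN : 0 < t ^ N := pow_pos (by linarith) N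
  have hcoret := ht₁ t (((le_max_right _ _).trans (le_max_left _ _)).trans ht)
  have hγ : ((L ∩ cube c t).ncard : ℝ) ≤ (l + ε) * t ^ N := (div_le_iff₀ htN).1 hc.le
  -- a much larger cube of density at least `U - ε`
  obtain ⟨T₀, hT₀⟩ := htrans t ht₀ c
  have hfat : ∀ᶠ T : ℝ in atTop, ((T + s) / T) ^ N < (U + 2 * ε) / (U + ε) :=
    (tendsto_add_div_pow s N).eventually_lt_const
      ((one_lt_div (by linarith)).2 (by linarith))
  obtain ⟨T₁, hT₁⟩ := eventually_atTop.1 hfat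
  obtain ⟨T, hT, a, ha⟩ := frequently_cubeFilter.1
    (frequently_lt_of_lt_limsup hbelow.isCoboundedUnder_le
      (show U - ε < limsup g (cubeFilter N) by linarith)) (max (max T₀ T₁) 1)
  have hTpos : 0 < T := zero_lt_one.trans_le ((le_max_right _ _).trans hT)
  have hTN : 0 < T ^ N := pow_pos hTpos N
  have hfatT := hT₁ T (((le_max_right _ _).trans (le_max_left _ _)).trans hT)
  obtain ⟨A, b, hsub, hdisj, hcount, hcard⟩ :=
    hT₀ T (((le_max_left _ _).trans (le_max_left _ _)).trans hT) a
  have hmain := ncard_inter_cube_le hfin hs ht2 hTpos.le hα a A b hsub hdisj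
    fun u hu => (Nat.cast_le.2 (hcount u hu)).trans hγ
  have hlow : (U - ε) * T ^ N < ((L ∩ cube a T).ncard : ℝ) := (lt_div_iff₀ hTN).1 ha
  rw [div_pow, div_lt_div_iff₀ (by linarith) htN] at hcoret
  rw [div_pow, div_lt_div_iff₀ hTN (by linarith)] at hfatT
  have e₁ : (T / s + 1) ^ N = (T + s) ^ N / s ^ N := by
    rw [← div_pow]; congr 1; field_simp
  have e₂ : (t / s - 2) ^ N = (t + -(2 * s)) ^ N / s ^ N := by
    rw [← div_pow]; congr 1; field_simp; ring
  have e₃ : (U + ε) * s ^ N * ((T + s) ^ N / s ^ N - A.card * ((t + -(2 * s)) ^ N / s ^ N)) =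
      (T + s) ^ N * (U + ε) - A.card * ((t + -(2 * s)) ^ N * (U + ε)) := by
    field_simp
  rw [e₁, e₂, e₃] at hmain
  have hcoreA := mul_le_mul_of_nonneg_left hcoret.le (Nat.cast_nonneg (α := ℝ) A.card)
  have hgain : (U - l) / 2 * (w * T ^ N) ≤ (U - l - ε) * (A.card * t ^ N) :=
    mul_le_mul (by linarith) hcard (by positivity) (by linarith)
  have hεT := mul_lt_mul_of_pos_right hεw hTN
  nlinarith

end Delone

/-- A repetitive Delone set satisfying (PQ) admits frequencies: for every
ball pattern `P = (x,R)` the limit `lim_{|C|→∞} ♯_P C / |C|` over cubes exists. -/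
theorem frequencies_exist {N : ℕ} (hN : 0 < N) (Λ : Set (Euc N))
    (hΛ : IsDelone Λ) (hrep : Repetitive Λ) (hPQ : PQ Λ) :
    ∀ x ∈ Λ, ∀ R : ℝ, 0 < R →
      ∃ L : ℝ, Filter.Tendsto
        (fun cs : Euc N × ℝ => (countP Λ x R (cube cs.1 cs.2) : ℝ) / cs.2 ^ N)
        (cubeFilter N) (nhds L) := by
  intro x hx R hR
  obtain ⟨l, hl⟩ := exists_tendsto_ncard_locSet hΛ hPQ x hR
  obtain ⟨hfin, -⟩ := hΛ.1.finite_inter_cube (L := locSet Λ x R) (Set.sep_subset _ _)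
  refine ⟨l, ?_⟩
  set shrink : Euc N × ℝ → Euc N × ℝ := fun cs =>
    (WithLp.toLp 2 fun i => cs.1 i + R, cs.2 + -(2 * R))
  have hshrink : Tendsto shrink (cubeFilter N) (cubeFilter N) := by
    refine Filter.Tendsto.prodMk tendsto_top ?_
    exact (tendsto_atTop_add_const_right _ _ tendsto_id).comp tendsto_snd
  have hratio : Tendsto (fun cs : Euc N × ℝ => ((cs.2 + -(2 * R)) / cs.2) ^ N)
      (cubeFilter N) (nhds 1) := (tendsto_add_div_pow (-(2 * R)) N).comp tendsto_snd
  have hlower := (hl.comp hshrink).mul hratio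
  rw [mul_one] at hlower
  refine tendsto_of_tendsto_of_tendsto_of_le_of_le' hlower hl ?_ ?_
  · refine eventually_cubeFilter.2 ⟨2 * R + 1, fun s hs a => ?_⟩
    have h₁ : 0 < s + -(2 * R) := by linarith
    have h₂ : 0 < s := by linarith
    have hle : (locSet Λ x R ∩ cube (shrink (a, s)).1 (shrink (a, s)).2).ncard ≤
        countP Λ x R (cube a s) := by
      refine Set.ncard_le_ncard (fun y hy => ⟨hy.1, fun p hp i => ?_⟩)
        ((hfin a s).subset fun y hy => ⟨hy.1, hy.2 (Metric.mem_closedBall_self hR.le)⟩)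
      have h₃ := abs_le.1 ((abs_apply_sub_le_dist p y i).trans hp)
      have h₄ := hy.2 i
      simp only [shrink] at h₄
      constructor <;> linarith [h₃.1, h₃.2, h₄.1, h₄.2]
    have hle' : ((locSet Λ x R ∩ cube (shrink (a, s)).1 (shrink (a, s)).2).ncard : ℝ) ≤
        countP Λ x R (cube a s) := by exact_mod_cast hle
    have hpow : (s + -(2 * R)) ^ N ≠ 0 := (pow_pos h₁ N).ne'
    simp only [Function.comp_apply]
    rw [div_pow, show (shrink (a, s)).2 = s + -(2 * R) from rfl, div_mul_div_cancel₀ hpow]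
    exact div_le_div_of_nonneg_right hle' (pow_pos h₂ N).le
  · refine eventually_cubeFilter.2 ⟨0, fun s hs a => ?_⟩
    refine div_le_div_of_nonneg_right (Nat.cast_le.2 ?_) (pow_nonneg hs N)
    exact Set.ncard_le_ncard
      (fun y hy => ⟨hy.1, hy.2 (Metric.mem_closedBall_self hR.le)⟩) (hfin a s)
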